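/- arXiv:2402.01820 — 2 statements merged into one kernel-verified Lean document; each statement's English description precedes it below -/
import Mathlib

section
/- Let x, κ, θ, η ∈ ℝ and set σ^OU := (x·𝟙 + κθ·e_1 + η·e_2) ⊗ exp_⧢(−κ·e_1) ∈ T((ℝ²)). Then: (i) the empty-word coefficient of σ^OU equals x; (ii) σ^OU π_1 = κθ·𝟙 − κ·σ^OU; (iii) σ^OU π_2 = η·𝟙; (iv) σ^OU π_{22} = 0, where π_u denotes right-deconcatenation by the word u. -/
/-- Words over the alphabet `{1, …, d}`, modeled as lists over `Fin d`. -/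
abbrev Word (d : ℕ) := List (Fin d)

/-- The extended tensor algebra `T((ℝ^d))`, modeled as real-valued functions on words. -/
abbrev Tensor (d : ℕ) := Word d → ℝ

namespace Sig

/-- The unit `𝟙`: the indicator of the empty word. -/
def unit (d : ℕ) : Tensor d := fun w => if w = [] then 1 else 0

/-- The concatenation product `(ℓ ⊗ p)(w) = Σ_{w = u·v} ℓ(u) p(v)`. -/
def concatProd {d : ℕ} (l p : Tensor d) : Tensor d :=
  fun w => ∑ i ∈ Finset.range (w.length + 1), l (w.take i) * p (w.drop i)

/-- `n`-fold concatenation power, `ℓ^⊗0 = 𝟙`. -/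
def concatPow {d : ℕ} (l : Tensor d) : ℕ → Tensor d
  | 0 => unit d
  | n + 1 => concatProd (concatPow l n) l

/-- The letter `e_i`: the indicator of the one-letter word `i`. -/
def letter {d : ℕ} (i : Fin d) : Tensor d := fun w => if w = [i] then 1 else 0

/-- The shuffle product on `T((ℝ^d))`, the coefficientwise bilinear extension of the
inductive shuffle of words. -/
def shuffle {d : ℕ} : Tensor d → Tensor d → Word d → ℝ
  | l, m, [] => l [] * m []
  | l, m, i :: w => shuffle (fun u => l (i :: u)) m w + shuffle l (fun u => m (i :: u)) w

/-- `n`-fold shuffle power, `ℓ^⧢0 = 𝟙`. -/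
def shufflePow {d : ℕ} (l : Tensor d) : ℕ → Tensor d
  | 0 => unit d
  | n + 1 => shuffle (shufflePow l n) l

/-- The resolvent `(𝟙 − q)^{-1} = Σ_{n≥0} q^⊗n`, defined coefficientwise. -/
noncomputable def resolvent {d : ℕ} (q : Tensor d) : Tensor d :=
  fun w => ∑' n : ℕ, concatPow q n w

/-- The shuffle exponential `exp_⧢(ℓ) = Σ_{n≥0} ℓ^⧢n / n!`, defined coefficientwise. -/
noncomputable def shuffleExp {d : ℕ} (l : Tensor d) : Tensor d :=
  fun w => ∑' n : ℕ, shufflePow l n w / (n.factorial : ℝ)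

/-- Right-deconcatenation (projection) by a word `u`: `(ℓ π_u)(w) = ℓ(w·u)`. -/
def proj {d : ℕ} (l : Tensor d) (u : Word d) : Tensor d := fun w => l (w ++ u)

/-- The tensor-algebra representation of the Ornstein–Uhlenbeck process:
`σ^OU = (x·𝟙 + κθ·e_1 + η·e_2) ⊗ exp_⧢(−κ·e_1)`. -/
noncomputable def sigmaOU (x kappa theta eta : ℝ) : Tensor 2 :=
  concatProd
    (x • unit 2 + (kappa * theta) • letter (0 : Fin 2) + eta • letter (1 : Fin 2))
    (shuffleExp ((-kappa) • letter (0 : Fin 2)))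

theorem shuffle_unit_right {d : ℕ} (c : ℝ) (l : Tensor d) (m : Tensor d) (w : Word d)
    (hm : ∀ u, m u = if u = [] then c else 0) : shuffle l m w = l w * c := by
  induction w generalizing l m c with
  | nil => simp [shuffle, hm]
  | cons i w ih =>
    simp only [shuffle]
    rw [ih c _ m hm, ih 0 l _ (by intro u; simp [hm])]
    simp

theorem shuffle_zero_left {d : ℕ} (l m : Tensor d) (w : Word d)
    (hl : ∀ u, l u = 0) : shuffle l m w = 0 := by
  induction w generalizing l m with
  | nil => simp [shuffle, hl]
  | cons i w ih =>
    simp only [shuffle]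
    rw [ih _ m (by intro u; simp [hl]), ih l _ hl]
    simp

theorem shuffle_replicate {d : ℕ} (j : Fin d) (c a : ℝ) (n : ℕ) (l : Tensor d) (w : Word d)
    (hl : ∀ u, l u = if u = List.replicate n j then a else 0) :
    shuffle l (c • letter j) w =
      if w = List.replicate (n + 1) j then a * c * (n + 1) else 0 := by
  induction w generalizing l n with
  | nil => simp [shuffle, letter, List.replicate_succ]
  | cons i w ih =>
    simp only [shuffle]
    by_cases hi : i = j
    · subst hi
      rw [shuffle_unit_right c l _ w (by intro u; simp [letter])]
      rw [hl w]
      cases n with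
      | zero =>
        rw [shuffle_zero_left _ _ _ (by intro u; simp [hl])]
        by_cases hw : w = [] <;> simp [hw]
      | succ m =>
        rw [ih m _ (by intro u; simp [hl, List.replicate_succ])]
        rw [List.replicate_succ (n := m + 1)]
        by_cases hw : w = List.replicate (m + 1) i
        · simp only [hw, if_true]; push_cast; ring
        · simp [hw]
    · rw [shuffle_unit_right 0 l _ w (by intro u; simp [letter, hi])]
      rw [shuffle_zero_left _ _ _ (by intro u; cases n <;> simp [hl, List.replicate_succ, hi])]
      simp [List.replicate_succ, hi]

theorem shufflePow_letter {d : ℕ} (j : Fin d) (c : ℝ) (n : ℕ) (w : Word d) :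
    shufflePow (c • letter j) n w =
      if w = List.replicate n j then c ^ n * (n.factorial : ℝ) else 0 := by
  induction n generalizing w with
  | zero => simp [shufflePow, unit]
  | succ n ih =>
    simp only [shufflePow]
    rw [shuffle_replicate j c _ n _ w ih]
    congr 1
    rw [Nat.factorial_succ]; push_cast; ring

theorem shuffleExp_letter {d : ℕ} (j : Fin d) (c : ℝ) (w : Word d) :
    shuffleExp (c • letter j) w = if (∀ i ∈ w, i = j) then c ^ w.length else 0 := by
  unfold shuffleExp
  rw [tsum_eq_single w.length]
  · rw [shufflePow_letter]
    have hf : (w.length.factorial : ℝ) ≠ 0 := by positivity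
    have h : w = List.replicate w.length j ↔ ∀ i ∈ w, i = j := by
      simp [List.eq_replicate_iff]
    by_cases hw : ∀ i ∈ w, i = j
    · rw [if_pos (h.2 hw), if_pos hw]; field_simp
    · rw [if_neg (fun e => hw (h.1 e)), if_neg hw]; simp
  · intro n hn
    rw [shufflePow_letter, if_neg]
    · simp
    · rintro rfl
      simp at hn

theorem concatProd_snoc {d : ℕ} (l p : Tensor d) (w : Word d) (a : Fin d) :
    concatProd l p (w ++ [a]) = l (w ++ [a]) * p [] + concatProd l (proj p [a]) w := by
  unfold concatProd proj
  rw [List.length_append, List.length_singleton, Finset.sum_range_succ, add_comm]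
  congr 1
  · rw [List.take_of_length_le (by simp), List.drop_of_length_le (by simp)]
  · apply Finset.sum_congr rfl
    intro i hi
    have hi' : i ≤ w.length := by simpa [Nat.lt_succ_iff] using hi
    rw [List.take_append_of_le_length hi', List.drop_append_of_le_length hi']

/-- the empty-word coefficient and the projections of `σ^OU`:
`(σ^OU)^∅ = x`, `σ^OU π_1 = κθ·𝟙 − κ·σ^OU`, `σ^OU π_2 = η·𝟙`, `σ^OU π_22 = 0`. -/
theorem sigmaOU_projections (x kappa theta eta : ℝ) :
    sigmaOU x kappa theta eta ([] : Word 2) = x ∧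
    proj (sigmaOU x kappa theta eta) [(0 : Fin 2)] =
      (kappa * theta) • unit 2 - kappa • sigmaOU x kappa theta eta ∧
    proj (sigmaOU x kappa theta eta) [(1 : Fin 2)] = eta • unit 2 ∧
    proj (sigmaOU x kappa theta eta) [(1 : Fin 2), (1 : Fin 2)] = 0 := by
  have hE := shuffleExp_letter (0 : Fin 2) (-kappa)
  have h0 : shuffleExp ((-kappa) • letter (0 : Fin 2)) [] = 1 := by rw [hE]; simp
  have hp0 : proj (shuffleExp ((-kappa) • letter (0 : Fin 2))) [0] =
      (-kappa) • shuffleExp ((-kappa) • letter (0 : Fin 2)) := by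
    funext w
    simp only [proj, hE, Pi.smul_apply, smul_eq_mul]
    by_cases hw : ∀ i ∈ w, i = (0 : Fin 2)
    · rw [if_pos hw, if_pos (by simpa using hw)]
      simp [pow_succ, mul_comm]
    · rw [if_neg hw, if_neg (by simpa using hw)]; simp
  have hp1 : proj (shuffleExp ((-kappa) • letter (0 : Fin 2))) [1] = 0 := by
    funext w
    simp only [proj, hE]
    rw [if_neg]
    · rfl
    · intro h
      have := h 1 (by simp)
      simp at this
  have h3 : ∀ w : Word 2, sigmaOU x kappa theta eta (w ++ [1]) = eta * unit 2 w := by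
    intro w
    unfold sigmaOU
    rw [concatProd_snoc, h0, hp1]
    cases w <;> simp [concatProd, unit, letter]
  refine ⟨?_, ?_, ?_, ?_⟩
  · simp [sigmaOU, concatProd, h0, unit, letter, -neg_smul]
  · funext w
    have : proj (sigmaOU x kappa theta eta) [0] w = sigmaOU x kappa theta eta (w ++ [0]) := rfl
    rw [this]
    unfold sigmaOU
    rw [concatProd_snoc, h0, hp0]
    have h2 : ∀ l p : Tensor 2, concatProd l ((-kappa) • p) w = - (kappa * concatProd l p w) := by
      intro l p
      simp only [concatProd, Pi.smul_apply, smul_eq_mul]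
      rw [Finset.mul_sum, ← Finset.sum_neg_distrib]
      exact Finset.sum_congr rfl (fun i _ => by ring)
    rw [h2, Pi.sub_apply, Pi.smul_apply, Pi.smul_apply, smul_eq_mul, smul_eq_mul, sub_eq_add_neg]
    congr 1
    cases w <;> simp [unit, letter]
  · funext w
    exact h3 w
  · funext w
    have := h3 (w ++ [1])
    simpa [proj, unit] using this

end Sig
end

section
/- Let y, κ, θ, η, α ∈ ℝ and set σ^mGBM := (y·𝟙 + (κθ − αη/2)·e_1 + η·e_2) ⊗ exp_⧢(−(κ + α²/2)·e_1 + α·e_2) ∈ T((ℝ²)). Then σ^mGBM solves the linear algebraic equation σ^mGBM = (y·𝟙 + (κθ − αη/2)·e_1 + η·e_2) + σ^mGBM ⊗ (−(κ + α²/2)·e_1 + α·e_2). -/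
namespace Sig

/-- The tensor-algebra representation of the mean-reverting geometric Brownian motion:
`σ^mGBM = (y·𝟙 + (κθ − αη/2)·e_1 + η·e_2) ⊗ exp_⧢(−(κ + α²/2)·e_1 + α·e_2)`. -/
noncomputable def sigmaMGBM (y kappa theta eta alpha : ℝ) : Tensor 2 :=
  concatProd
    (y • unit 2 + (kappa * theta - alpha * eta / 2) • letter (0 : Fin 2) +
      eta • letter (1 : Fin 2))
    (shuffleExp ((-(kappa + alpha ^ 2 / 2)) • letter (0 : Fin 2) + alpha • letter (1 : Fin 2)))

/-- The linear element with letter coefficients `c`. -/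
def Lin {d : ℕ} (c : Fin d → ℝ) : Tensor d
  | [] => 0
  | [i] => c i
  | _ :: _ :: _ => 0

/-- The product of letter coefficients on words of length `n`, scaled by `n!`. -/
def Fp {d : ℕ} (c : Fin d → ℝ) (n : ℕ) : Tensor d :=
  fun w => if w.length = n then (n.factorial : ℝ) * (w.map c).prod else 0

lemma shuffle_smul_left {d : ℕ} (k : ℝ) (w : Word d) : ∀ (l m : Tensor d),
    shuffle (fun u => k * l u) m w = k * shuffle l m w := by
  induction w with
  | nil => intro l m; simp only [shuffle]; ring
  | cons i w ih =>
    intro l m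
    simp only [shuffle]
    rw [ih (fun u => l (i :: u)) m, ih]; ring

lemma shuffle_zero_right {d : ℕ} (w : Word d) : ∀ (l : Tensor d),
    shuffle l (fun _ => 0) w = 0 := by
  induction w with
  | nil => intro l; simp [shuffle]
  | cons i w ih => intro l; simp only [shuffle]; rw [ih, ih]; ring

lemma shuffle_unit {d : ℕ} (k : ℝ) (w : Word d) : ∀ (l : Tensor d),
    shuffle l (fun u => if u = [] then k else 0) w = k * l w := by
  induction w with
  | nil => intro l; simp [shuffle, mul_comm]
  | cons i w ih =>
    intro l
    simp only [shuffle]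
    rw [ih]
    simp [shuffle_zero_right]

lemma Lin_cons {d : ℕ} (c : Fin d → ℝ) (i : Fin d) :
    (fun u => Lin c (i :: u)) = fun u => if u = [] then c i else 0 := by
  funext u
  cases u <;> simp [Lin]

lemma shuffle_Fp {d : ℕ} (c : Fin d → ℝ) (w : Word d) : ∀ n : ℕ,
    shuffle (Fp c n) (Lin c) w = Fp c (n + 1) w := by
  induction w with
  | nil => intro n; simp [shuffle, Lin, Fp]
  | cons i w ih =>
    intro n
    simp only [shuffle]
    rw [Lin_cons, shuffle_unit]
    cases n with
    | zero =>
      have h : (fun u => Fp c 0 (i :: u)) = fun u => (0 : ℝ) * Fp c 0 u := by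
        funext u; simp [Fp]
      rw [h, shuffle_smul_left]
      simp [Fp]
    | succ n =>
      have h : (fun u => Fp c (n + 1) (i :: u)) =
          fun u => (((n : ℝ) + 1) * c i) * Fp c n u := by
        funext u
        simp only [Fp, List.length_cons, Nat.add_right_cancel_iff, List.map_cons, List.prod_cons]
        split_ifs
        · rw [Nat.factorial_succ]; push_cast; ring
        · ring
      rw [h, shuffle_smul_left, ih]
      simp only [Fp, List.length_cons, Nat.add_right_cancel_iff, List.map_cons, List.prod_cons]
      split_ifs
      · rw [Nat.factorial_succ (n + 1)]; push_cast; ring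
      · ring

lemma shufflePow_Lin {d : ℕ} (c : Fin d → ℝ) (n : ℕ) : shufflePow (Lin c) n = Fp c n := by
  induction n with
  | zero =>
    funext w
    cases w <;> simp [shufflePow, unit, Fp]
  | succ n ih =>
    funext w
    rw [shufflePow, ih, shuffle_Fp]

lemma shuffleExp_Lin {d : ℕ} (c : Fin d → ℝ) (w : Word d) :
    shuffleExp (Lin c) w = (w.map c).prod := by
  simp only [shuffleExp, shufflePow_Lin]
  rw [tsum_eq_single w.length]
  · simp only [Fp, if_true]
    have : ((w.length.factorial : ℕ) : ℝ) ≠ 0 := by positivity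
    field_simp
  · intro n hn
    simp [Fp, hn.symm]

lemma Lin_of_two_le {d : ℕ} (c : Fin d → ℝ) (w : Word d) (h : 2 ≤ w.length) : Lin c w = 0 := by
  match w, h with
  | _ :: _ :: _, _ => rfl

lemma concatProd_Lin {d : ℕ} (c : Fin d → ℝ) (s : Tensor d) (w : Word d) (j : Fin d) :
    concatProd s (Lin c) (w ++ [j]) = s w * c j := by
  unfold concatProd
  rw [List.length_append, List.length_singleton, Finset.sum_range_succ, Finset.sum_range_succ,
    Finset.sum_eq_zero]
  · simp [Lin]
  · intro i hi
    rw [Finset.mem_range] at hi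
    rw [Lin_of_two_le, mul_zero]
    simp; omega

lemma concatProd_exp {d : ℕ} (c : Fin d → ℝ) (p : Tensor d) :
    concatProd p (shuffleExp (Lin c)) =
      p + concatProd (concatProd p (shuffleExp (Lin c))) (Lin c) := by
  funext w
  rw [Pi.add_apply]
  induction w using List.reverseRecOn with
  | nil => simp [concatProd, shuffleExp_Lin, Lin]
  | append_singleton w j _ =>
    rw [concatProd_Lin]
    unfold concatProd
    rw [List.length_append, List.length_singleton, Finset.sum_range_succ, Finset.sum_mul, add_comm]
    congr 1
    · rw [List.take_of_length_le (by simp), List.drop_of_length_le (by simp)]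
      simp [shuffleExp_Lin]
    · refine Finset.sum_congr rfl fun i hi => ?_
      rw [Finset.mem_range] at hi
      have hi' : i ≤ w.length := by omega
      rw [List.take_append_of_le_length hi', List.drop_append_of_le_length hi']
      simp [shuffleExp_Lin, mul_assoc]

lemma lin_two (a b : ℝ) :
    a • letter (0 : Fin 2) + b • letter (1 : Fin 2) = Lin ![a, b] := by
  funext w
  match w with
  | [] => simp [letter, Lin]
  | [i] => fin_cases i <;> simp [letter, Lin]
  | _ :: _ :: _ => simp [letter, Lin]

/-- `σ^mGBM` solves
`σ^mGBM = (y·𝟙 + (κθ − αη/2)·e_1 + η·e_2) + σ^mGBM ⊗ (−(κ + α²/2)·e_1 + α·e_2)`. -/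
theorem sigmaMGBM_solves_linear_eq (y kappa theta eta alpha : ℝ) :
    sigmaMGBM y kappa theta eta alpha =
      (y • unit 2 + (kappa * theta - alpha * eta / 2) • letter (0 : Fin 2) +
        eta • letter (1 : Fin 2)) +
      concatProd (sigmaMGBM y kappa theta eta alpha)
        ((-(kappa + alpha ^ 2 / 2)) • letter (0 : Fin 2) + alpha • letter (1 : Fin 2)) := by
  unfold sigmaMGBM
  rw [lin_two]
  exact concatProd_exp _ _

end Sig
end
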